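/- arXiv:1107.4137 — 2 statements merged into one kernel-verified Lean document; each statement's English description precedes it below -/
import Mathlib

section
/- Fix l = 2m+1, m > 0, and let x₁, …, x_m be indeterminates over ℤ/2; extend the indexing by setting x_{l−k} := x_k for 1 ≤ k ≤ m, and more generally read indices of the x's mod l up to sign. For m ≥ i > j ≥ 1 define R_{i,j} = x_i^4·x_{2j} + x_j^4·x_{2i} + x_{2i}·x_{2j} + x_{i+j}²·x_{i−j}² in ℤ/2[x₁,…,x_m]. Then for every r prime to l, each R_{i,j} lies in the kernel of the ring homomorphism φ_r : ℤ/2[x₁,…,x_m] → S sending x_k to [rk]. -/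
open scoped Classical

/-- The theta series `[i]` for modulus `l`: `∑ x^(n²)` over integers `n ≡ i (mod l)`,
viewed in `ℤ/2[[x]]` (the coefficient of `x^k` is the mod-2 count of such `n` with `n² = k`). -/
noncomputable def theta (l i : ℤ) : PowerSeries (ZMod 2) :=
  PowerSeries.mk fun k => (({n : ℤ | n ≡ i [ZMOD l] ∧ n ^ 2 = (k : ℤ)}.ncard : ℕ) : ZMod 2)

/-- The theta series viewed in the Laurent series field `L = ℤ/2((x))`. -/
noncomputable def thetaL (l i : ℤ) : LaurentSeries (ZMod 2) := (theta l i : LaurentSeries (ZMod 2))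

/-- The projection `p_{q,j}` keeping only the coefficients in degrees `≡ j (mod q)`. -/
noncomputable def proj (q j : ℤ) (f : LaurentSeries (ZMod 2)) : LaurentSeries (ZMod 2) where
  coeff n := if n ≡ j [ZMOD q] then f.coeff n else 0
  isPWO_support' := f.isPWO_support'.mono (fun n hn => by
    simp only [Function.mem_support, ne_eq] at hn ⊢
    intro h; apply hn; split_ifs <;> simp [h])

/-- `B(g)`: the set of integers `n` such that the coefficient of `x^n` in `1/g` is `1`. -/
noncomputable def Bset (g : PowerSeries (ZMod 2)) : Set ℤ :=
  {n : ℤ | ((g : LaurentSeries (ZMod 2))⁻¹).coeff n = 1}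

/-- The subring `S` of `L` generated over `ℤ/2` by `[1], …, [m]`. -/
noncomputable def Sring (l : ℤ) (m : ℕ) : Subring (LaurentSeries (ZMod 2)) :=
  Subring.closure {x | ∃ i : ℕ, 1 ≤ i ∧ i ≤ m ∧ x = thetaL l i}

/-- The subring `S` of `ℤ/2[[x]]` generated over `ℤ/2` by `[1], …, [m]`. -/
noncomputable def SringPS (l : ℤ) (m : ℕ) : Subring (PowerSeries (ZMod 2)) :=
  Subring.closure {x | ∃ i : ℕ, 1 ≤ i ∧ i ≤ m ∧ x = theta l i}

/-- The variable `x_k` of `ℤ/2[x₁, …, x_m]` for an integer index `k`, where indices are read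
mod `l = 2m+1` up to sign (so `x_{l-k} = x_k`); indices `≡ 0 (mod l)` give `0` (unused). -/
noncomputable def xvar (m : ℕ) (k : ℤ) : MvPolynomial (Fin m) (ZMod 2) :=
  if h : 1 ≤ (k % (2 * (m : ℤ) + 1)).toNat ∧ (k % (2 * (m : ℤ) + 1)).toNat ≤ m then
    MvPolynomial.X ⟨(k % (2 * (m : ℤ) + 1)).toNat - 1, by omega⟩
  else if h2 : m + 1 ≤ (k % (2 * (m : ℤ) + 1)).toNat ∧ (k % (2 * (m : ℤ) + 1)).toNat ≤ 2 * m then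
    MvPolynomial.X ⟨2 * m - (k % (2 * (m : ℤ) + 1)).toNat, by omega⟩
  else 0

/-- The quintic relation `R_{i,j} = x_i⁴·x_{2j} + x_j⁴·x_{2i} + x_{2i}·x_{2j} + x_{i+j}²·x_{i-j}²`. -/
noncomputable def QRel (m : ℕ) (i j : ℤ) : MvPolynomial (Fin m) (ZMod 2) :=
  xvar m i ^ 4 * xvar m (2 * j) + xvar m j ^ 4 * xvar m (2 * i) +
    xvar m (2 * i) * xvar m (2 * j) + xvar m (i + j) ^ 2 * xvar m (i - j) ^ 2

/-- The homomorphism `φ_r : ℤ/2[x₁, …, x_m] → ℤ/2[[x]]` sending `x_k` to `[rk]`. -/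
noncomputable def phi (l : ℤ) (m : ℕ) (r : ℤ) :
    MvPolynomial (Fin m) (ZMod 2) →+* PowerSeries (ZMod 2) :=
  (MvPolynomial.aeval fun k : Fin m => theta l (r * ((k : ℕ) + 1))).toRingHom

/-- The ideal `N` generated by the quintic relations `R_{i,j}`, `m ≥ i > j ≥ 1`. -/
noncomputable def Nideal (m : ℕ) : Ideal (MvPolynomial (Fin m) (ZMod 2)) :=
  Ideal.span {P | ∃ i j : ℤ, 1 ≤ j ∧ j < i ∧ i ≤ (m : ℤ) ∧ P = QRel m i j}

/-- The series `∑ x^(w i)` over `i ∈ s`, with coefficients counted mod 2. -/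
noncomputable def weightSeries {ι : Type*} (s : Set ι) (w : ι → ℕ) : PowerSeries (ZMod 2) :=
  PowerSeries.mk fun k => (({i | i ∈ s ∧ w i = k}.ncard : ℕ) : ZMod 2)

theorem weightSeries_congr {ι κ : Type*} {s : Set ι} {t : Set κ} {w : ι → ℕ} {v : κ → ℕ}
    (f : ι → κ) (hf : Set.BijOn f s t) (h : ∀ i ∈ s, v (f i) = w i) :
    weightSeries s w = weightSeries t v := by
  ext k
  simp only [weightSeries, PowerSeries.coeff_mk]
  congr 1
  refine Set.ncard_congr (fun i _ => f i) ?_ ?_ ?_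
  · rintro i ⟨hi, rfl⟩
    exact ⟨hf.mapsTo hi, h i hi⟩
  · rintro i j ⟨hi, -⟩ ⟨hj, -⟩ hij
    exact hf.injOn hi hj hij
  · rintro b ⟨hb, rfl⟩
    obtain ⟨i, hi, rfl⟩ := hf.surjOn hb
    exact ⟨i, ⟨hi, (h i hi).symm⟩, rfl⟩

theorem weightSeries_union {ι : Type*} {s t : Set ι} {w : ι → ℕ} (hst : Disjoint s t)
    (hw : ∀ k, {i | w i = k}.Finite) :
    weightSeries (s ∪ t) w = weightSeries s w + weightSeries t w := by
  ext k
  simp only [weightSeries, PowerSeries.coeff_mk, map_add]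
  rw [← Nat.cast_add, ← Set.ncard_union_eq _ ((hw k).subset fun i hi => hi.2)
    ((hw k).subset fun i hi => hi.2)]
  · congr 2
    ext i
    simp only [Set.mem_union, Set.mem_ofPred_eq]
    tauto
  · exact hst.mono (fun i hi => hi.1) (fun i hi => hi.1)

theorem weightSeries_mul {ι κ : Type*} (s : Set ι) (t : Set κ) {w : ι → ℕ} {v : κ → ℕ}
    (hw : ∀ k, {i | w i = k}.Finite) (hv : ∀ k, {i | v i = k}.Finite) :
    weightSeries s w * weightSeries t v =
      weightSeries (s ×ˢ t) fun p => w p.1 + v p.2 := by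
  ext k
  simp only [weightSeries, PowerSeries.coeff_mul, PowerSeries.coeff_mk]
  have h : {p : ι × κ | p ∈ s ×ˢ t ∧ w p.1 + v p.2 = k} =
      ⋃ b ∈ (Finset.HasAntidiagonal.antidiagonal k : Set (ℕ × ℕ)),
        {i | i ∈ s ∧ w i = b.1} ×ˢ {j | j ∈ t ∧ v j = b.2} := by
    ext ⟨i, j⟩
    simp only [Set.mem_ofPred_eq, Set.mem_prod, Set.mem_iUnion, Finset.mem_coe,
      Finset.HasAntidiagonal.mem_antidiagonal, exists_prop, Prod.exists]
    constructor
    · rintro ⟨⟨hi, hj⟩, hk⟩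
      exact ⟨w i, v j, hk, ⟨hi, rfl⟩, hj, rfl⟩
    · rintro ⟨a, b, hk, ⟨hi, rfl⟩, hj, rfl⟩
      exact ⟨⟨hi, hj⟩, hk⟩
  rw [h, Set.Finite.ncard_biUnion (Finset.finite_toSet _), finsum_mem_coe_finset]
  · simp only [Set.ncard_prod, Nat.cast_sum, Nat.cast_mul]
  · exact fun b _ => ((hw b.1).subset fun i hi => hi.2).prod ((hv b.2).subset fun i hi => hi.2)
  · rintro ⟨a, b⟩ - ⟨c, d⟩ - hne
    refine Set.disjoint_left.2 ?_
    rintro ⟨i, j⟩ ⟨⟨-, rfl⟩, -, rfl⟩ ⟨⟨-, rfl⟩, -, rfl⟩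
    exact hne rfl

theorem sq_eq_expand_two (f : PowerSeries (ZMod 2)) :
    f ^ 2 = PowerSeries.expand 2 two_ne_zero f := by
  have h := MvPowerSeries.map_frobenius_expand (R := ZMod 2) (p := 2) two_ne_zero (f := f)
  rw [ZMod.frobenius_zmod, MvPowerSeries.map_id] at h
  exact h.symm

theorem weightSeries_sq {ι : Type*} (s : Set ι) (w : ι → ℕ) :
    weightSeries s w ^ 2 = weightSeries s fun i => 2 * w i := by
  rw [sq_eq_expand_two]
  ext k
  rw [PowerSeries.coeff_expand]
  simp only [weightSeries, PowerSeries.coeff_mk]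
  split_ifs with hk
  · obtain ⟨k, rfl⟩ := hk
    simp
  · rw [eq_comm, show {i | i ∈ s ∧ 2 * w i = k} = ∅ from ?_]
    · simp
    · refine Set.eq_empty_of_forall_notMem ?_
      rintro i ⟨-, rfl⟩
      exact hk ⟨_, rfl⟩

theorem finite_natAbs_sq_eq (k : ℕ) : {n : ℤ | n.natAbs ^ 2 = k}.Finite := by
  refine (Set.finite_Icc (-(k : ℤ)) k).subset ?_
  rintro n rfl
  have : n.natAbs ≤ n.natAbs ^ 2 := Nat.le_self_pow two_ne_zero _
  simp only [Set.mem_Icc]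
  omega

theorem theta_eq_weightSeries (l i : ℤ) :
    theta l i = weightSeries {n | n ≡ i [ZMOD l]} fun n => n.natAbs ^ 2 := by
  ext k
  simp only [theta, weightSeries, PowerSeries.coeff_mk, Set.mem_ofPred_eq]
  congr! 5 with n
  rw [← Int.natAbs_sq n]
  norm_cast

theorem theta_congr {l i j : ℤ} (h : i ≡ j [ZMOD l]) : theta l i = theta l j := by
  rw [theta_eq_weightSeries, theta_eq_weightSeries]
  congr 1
  ext n
  exact ⟨fun hn => hn.trans h, fun hn => hn.trans h.symm⟩

theorem theta_neg (l i : ℤ) : theta l (-i) = theta l i := by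
  rw [theta_eq_weightSeries, theta_eq_weightSeries]
  refine weightSeries_congr (fun n => -n) ⟨?_, neg_injective.injOn, ?_⟩ (by simp)
  · intro n hn
    simpa using Int.ModEq.neg hn
  · intro n hn
    exact ⟨-n, Int.ModEq.neg hn, by simp⟩

theorem modEq_of_two_mul_modEq {l a b : ℤ} (hl : Odd l) (h : 2 * a ≡ 2 * b [ZMOD l]) :
    a ≡ b [ZMOD l] := by
  obtain ⟨c, rfl⟩ := hl
  rw [Int.modEq_iff_dvd, ← mul_sub] at *
  exact IsCoprime.dvd_of_dvd_mul_left ⟨1, -c, by ring⟩ h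

/-- The part of `theta l i` indexed by integers `n` with `n ≡ e (mod 2)`. -/
noncomputable def thetaParity (l e i : ℤ) : PowerSeries (ZMod 2) :=
  weightSeries {n | n ≡ i [ZMOD l] ∧ n % 2 = e} fun n => n.natAbs ^ 2

theorem theta_eq_thetaParity_add (l i : ℤ) :
    theta l i = thetaParity l 0 i + thetaParity l 1 i := by
  rw [theta_eq_weightSeries, thetaParity, thetaParity,
    ← weightSeries_union _ finite_natAbs_sq_eq]
  · congr 1
    ext n
    simp only [Set.mem_union, Set.mem_ofPred_eq, ← and_or_left, Int.emod_two_eq_zero_or_one,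
      and_true]
  · rw [Set.disjoint_left]
    rintro n ⟨-, h⟩ ⟨-, h'⟩
    omega

theorem theta_pow_four {l : ℤ} (hl : Odd l) (a : ℤ) :
    theta l a ^ 4 = thetaParity l 0 (2 * a) := by
  rw [theta_eq_weightSeries, show 4 = 2 * 2 from rfl, pow_mul, weightSeries_sq, weightSeries_sq,
    thetaParity]
  refine weightSeries_congr (fun n => 2 * n) ⟨?_, ?_, ?_⟩ ?_
  · exact fun n hn => ⟨Int.ModEq.mul_left 2 hn, by simp⟩
  · intro n _ n' _ h
    simpa using h
  · rintro n ⟨hn, h⟩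
    obtain ⟨n, rfl⟩ := Int.dvd_of_emod_eq_zero h
    exact ⟨n, modEq_of_two_mul_modEq hl hn, rfl⟩
  · intro n _
    simp only [Int.natAbs_mul]
    ring_nf

theorem theta_sq_mul_theta_sq {l : ℤ} (hl : Odd l) (a b : ℤ) :
    theta l (a + b) ^ 2 * theta l (a - b) ^ 2 =
      thetaParity l 0 (2 * a) * thetaParity l 0 (2 * b) +
        thetaParity l 1 (2 * a) * thetaParity l 1 (2 * b) := by
  have hfin (k : ℕ) : {p : ℤ × ℤ | p.1.natAbs ^ 2 + p.2.natAbs ^ 2 = k}.Finite := by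
    refine ((Set.finite_Icc (-(k : ℤ)) k).prod (Set.finite_Icc (-(k : ℤ)) k)).subset ?_
    rintro ⟨n, n'⟩ rfl
    have : n.natAbs ≤ n.natAbs ^ 2 := Nat.le_self_pow two_ne_zero _
    have : n'.natAbs ≤ n'.natAbs ^ 2 := Nat.le_self_pow two_ne_zero _
    simp only [Set.mem_prod, Set.mem_Icc]
    omega
  rw [← mul_pow, theta_eq_weightSeries, theta_eq_weightSeries,
    weightSeries_mul _ _ finite_natAbs_sq_eq finite_natAbs_sq_eq, weightSeries_sq]
  simp only [thetaParity]
  rw [weightSeries_mul _ _ finite_natAbs_sq_eq finite_natAbs_sq_eq,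
    weightSeries_mul _ _ finite_natAbs_sq_eq finite_natAbs_sq_eq, ← weightSeries_union _ hfin]
  · refine weightSeries_congr (fun p => (p.1 + p.2, p.1 - p.2)) ⟨?_, ?_, ?_⟩ ?_
    · rintro ⟨u, v⟩ ⟨hu, hv⟩
      have h₁ : u + v ≡ 2 * a [ZMOD l] := by convert Int.ModEq.add hu hv using 1; ring
      have h₂ : u - v ≡ 2 * b [ZMOD l] := by convert Int.ModEq.sub hu hv using 1; ring
      rcases Int.emod_two_eq_zero_or_one (u + v) with h | h
      · exact Or.inl ⟨⟨h₁, h⟩, h₂, by simp only; omega⟩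
      · exact Or.inr ⟨⟨h₁, h⟩, h₂, by simp only; omega⟩
    · rintro ⟨u, v⟩ _ ⟨u', v'⟩ _ h
      simp only [Prod.mk.injEq] at h ⊢
      omega
    · rintro ⟨n, n'⟩ h
      have key : (n ≡ 2 * a [ZMOD l] ∧ n' ≡ 2 * b [ZMOD l]) ∧ n % 2 = n' % 2 := by
        rcases h with ⟨⟨h₁, h⟩, h₂, h'⟩ | ⟨⟨h₁, h⟩, h₂, h'⟩ <;>
          exact ⟨⟨h₁, h₂⟩, h.trans h'.symm⟩
      obtain ⟨⟨h₁, h₂⟩, h⟩ := key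
      obtain ⟨v, hv⟩ : (2 : ℤ) ∣ n - n' := by omega
      obtain rfl : n = n' + 2 * v := by omega
      refine ⟨(n' + v, v), ⟨modEq_of_two_mul_modEq hl ?_, modEq_of_two_mul_modEq hl ?_⟩, ?_⟩
      · convert Int.ModEq.add h₁ h₂ using 1 <;> ring
      · convert Int.ModEq.sub h₁ h₂ using 1 <;> ring
      · simp only [Prod.mk.injEq]
        constructor <;> ring
    · rintro ⟨u, v⟩ _
      zify
      simp only [sq_abs]
      ring
  · rw [Set.disjoint_left]
    rintro ⟨n, n'⟩ ⟨⟨-, h⟩, -⟩ ⟨⟨-, h'⟩, -⟩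
    simp only at h h'
    omega

theorem phi_xvar (m : ℕ) (r k : ℤ) (hk : ¬ (2 * (m : ℤ) + 1) ∣ k) :
    phi (2 * m + 1) m r (xvar m k) = theta (2 * m + 1) (r * k) := by
  have hmod := Int.mod_modEq k (2 * m + 1)
  have h₀ : 0 ≤ k % (2 * (m : ℤ) + 1) := Int.emod_nonneg _ (by omega)
  have h₁ : k % (2 * (m : ℤ) + 1) < 2 * m + 1 := Int.emod_lt_of_pos _ (by omega)
  have h₂ : k % (2 * (m : ℤ) + 1) ≠ 0 := fun h => hk (Int.dvd_of_emod_eq_zero h)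
  rw [xvar]
  simp only [phi]
  split_ifs with h h'
  · simp only [AlgHom.toRingHom_eq_coe, RingHom.coe_coe, MvPolynomial.aeval_X]
    refine theta_congr (Int.ModEq.mul_left r ?_)
    rwa [Nat.cast_sub h.1, Nat.cast_one, sub_add_cancel, Int.toNat_of_nonneg h₀]
  · simp only [AlgHom.toRingHom_eq_coe, RingHom.coe_coe, MvPolynomial.aeval_X]
    rw [← theta_neg, ← mul_neg]
    refine theta_congr (Int.ModEq.mul_left r (Int.ModEq.trans ?_ hmod))
    rw [Nat.cast_sub h'.2, Int.toNat_of_nonneg h₀, Int.modEq_iff_dvd]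
    exact ⟨1, by push_cast; ring⟩
  · omega

theorem theta_quintic_relation {l : ℤ} (hl : Odd l) (a b : ℤ) :
    theta l a ^ 4 * theta l (2 * b) + theta l b ^ 4 * theta l (2 * a) +
      theta l (2 * a) * theta l (2 * b) + theta l (a + b) ^ 2 * theta l (a - b) ^ 2 = 0 := by
  rw [theta_sq_mul_theta_sq hl, theta_pow_four hl, theta_pow_four hl,
    theta_eq_thetaParity_add l (2 * a), theta_eq_thetaParity_add l (2 * b)]
  have h : (2 : PowerSeries (ZMod 2)) = 0 := by
    rw [← map_ofNat (PowerSeries.C (R := ZMod 2)) 2,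
      show (OfNat.ofNat 2 : ZMod 2) = 0 from rfl, map_zero]
  linear_combination (2 * thetaParity l 0 (2 * a) * thetaParity l 0 (2 * b) +
    thetaParity l 0 (2 * a) * thetaParity l 1 (2 * b) +
    thetaParity l 1 (2 * a) * thetaParity l 0 (2 * b) +
    thetaParity l 1 (2 * a) * thetaParity l 1 (2 * b)) * h

theorem stmt12 (m : ℕ) (hm : 0 < m) (l : ℤ) (hl : l = 2 * m + 1)
    (r : ℤ) (hr : IsCoprime r l) (i j : ℤ) (h1 : 1 ≤ j) (h2 : j < i) (h3 : i ≤ (m : ℤ)) :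
    phi l m r (QRel m i j) = 0 := by
  subst hl
  have hodd : Odd (2 * (m : ℤ) + 1) := ⟨m, rfl⟩
  have hndvd {k : ℤ} (h₀ : 0 < k) (h₁ : k < 2 * m + 1) : ¬ (2 * (m : ℤ) + 1) ∣ k :=
    fun h => absurd (Int.le_of_dvd h₀ h) (by omega)
  simp only [QRel, map_add, map_mul, map_pow]
  rw [phi_xvar m r i (hndvd (by omega) (by omega)), phi_xvar m r j (hndvd (by omega) (by omega)),
    phi_xvar m r (2 * i) (hndvd (by omega) (by omega)),
    phi_xvar m r (2 * j) (hndvd (by omega) (by omega)),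
    phi_xvar m r (i + j) (hndvd (by omega) (by omega)),
    phi_xvar m r (i - j) (hndvd (by omega) (by omega))]
  simpa only [mul_add, mul_sub, mul_left_comm r 2] using
    theta_quintic_relation hodd (r * i) (r * j)
end

section
/- Let l = 5, let r be 1 or 2, and set a = [r], b = [2r]. Then p_{8,0}(1/a) = b^16. -/
open scoped Classical

/-- All exponents occurring in the power series `f` are congruent to `j` modulo `q`. -/
def SupportedMod (q j : ℕ) (f : PowerSeries (ZMod 2)) : Prop :=
  ∀ n, PowerSeries.coeff n f ≠ 0 → n ≡ j [MOD q]

namespace SupportedMod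

variable {q j k : ℕ} {f g : PowerSeries (ZMod 2)}

theorem add (hf : SupportedMod q j f) (hg : SupportedMod q j g) : SupportedMod q j (f + g) := by
  intro n hn
  by_cases h : PowerSeries.coeff n f = 0
  · exact hg n (by simpa [h] using hn)
  · exact hf n h

theorem mul (hf : SupportedMod q j f) (hg : SupportedMod q k g) :
    SupportedMod q (j + k) (f * g) := by
  intro n hn
  rw [PowerSeries.coeff_mul] at hn
  obtain ⟨p, hp, hne⟩ := Finset.exists_ne_zero_of_sum_ne_zero hn
  rw [← Finset.HasAntidiagonal.mem_antidiagonal.mp hp]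
  exact (hf _ (left_ne_zero_of_mul hne)).add (hg _ (right_ne_zero_of_mul hne))

theorem congr (hf : SupportedMod q j f) (h : j ≡ k [MOD q]) : SupportedMod q k f :=
  fun n hn => (hf n hn).trans h

theorem of_dvd {d : ℕ} (hf : SupportedMod q j f) (h : d ∣ q) : SupportedMod d j f :=
  fun n hn => (hf n hn).of_dvd h

theorem one_zero (f : PowerSeries (ZMod 2)) : SupportedMod 1 0 f :=
  fun _ _ => Nat.modEq_one

theorem coeff_eq_zero (hf : SupportedMod q j f) {n : ℕ} (h : ¬ n ≡ j [MOD q]) :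
    PowerSeries.coeff n f = 0 := by
  by_contra hn
  exact h (hf n hn)

end SupportedMod

theorem PowerSeries.two_eq_zero_zmod_two : (2 : PowerSeries (ZMod 2)) = 0 :=
  (map_ofNat (PowerSeries.C (R := ZMod 2)) 2).symm.trans
    ((congrArg PowerSeries.C CharTwo.two_eq_zero).trans (map_zero _))

theorem PowerSeries.expand_two_zmod_two (f : PowerSeries (ZMod 2)) :
    PowerSeries.expand 2 two_ne_zero f = f ^ 2 := by
  have h := MvPowerSeries.map_frobenius_expand (σ := Unit) (R := ZMod 2) 2 two_ne_zero (f := f)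
  rw [ZMod.frobenius_zmod, MvPowerSeries.map_id] at h
  exact h

theorem PowerSeries.coeff_sq_zmod_two (f : PowerSeries (ZMod 2)) (n : ℕ) :
    coeff n (f ^ 2) = if 2 ∣ n then coeff (n / 2) f else 0 := by
  rw [← expand_two_zmod_two, coeff_expand]

theorem PowerSeries.coeff_pow_four_zmod_two (f : PowerSeries (ZMod 2)) (n : ℕ) :
    coeff n (f ^ 4) = if 4 ∣ n then coeff (n / 4) f else 0 := by
  rw [show f ^ 4 = (f ^ 2) ^ 2 by ring, coeff_sq_zmod_two, coeff_sq_zmod_two, Nat.div_div_eq_div_mul]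
  split_ifs <;> first | rfl | omega

theorem SupportedMod.sq {q j : ℕ} {f : PowerSeries (ZMod 2)} (hf : SupportedMod q j f) :
    SupportedMod (2 * q) (2 * j) (f ^ 2) := by
  intro n hn
  rw [PowerSeries.coeff_sq_zmod_two] at hn
  split_ifs at hn with h
  · obtain ⟨m, rfl⟩ := h
    rw [Nat.mul_div_cancel_left _ two_pos] at hn
    exact (hf m hn).mul_left' 2
  · exact absurd rfl hn

theorem SupportedMod.pow_four {q j : ℕ} {f : PowerSeries (ZMod 2)} (hf : SupportedMod q j f) :
    SupportedMod (4 * q) (4 * j) (f ^ 4) := by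
  have h := hf.sq.sq
  rwa [← pow_mul, ← mul_assoc, ← mul_assoc] at h

theorem SupportedMod.pow_eight {q j : ℕ} {f : PowerSeries (ZMod 2)} (hf : SupportedMod q j f) :
    SupportedMod (8 * q) (8 * j) (f ^ 8) := by
  have h := hf.sq.pow_four
  rwa [← pow_mul, ← mul_assoc, ← mul_assoc] at h

theorem supportedMod_theta_add_pow_four (r : ℤ) :
    SupportedMod 8 1 (theta 5 r + theta 5 (2 * r) ^ 4) := by
  intro n hn
  by_contra h1
  apply hn
  rw [map_add, PowerSeries.coeff_pow_four_zmod_two]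
  split_ifs with h4
  · obtain ⟨m, rfl⟩ := h4
    rw [Nat.mul_div_cancel_left _ (by norm_num)]
    suffices PowerSeries.coeff (4 * m) (theta 5 r) = PowerSeries.coeff m (theta 5 (2 * r)) by
      rw [this, CharTwo.add_self_eq_zero]
    simp only [theta, PowerSeries.coeff_mk]
    congr 1
    symm
    refine Set.ncard_congr (fun n _ => -2 * n) ?_ ?_ ?_
    · rintro n ⟨h, h'⟩
      refine ⟨?_, by push_cast; linear_combination 4 * h'⟩
      rw [Int.ModEq] at *
      omega
    · intro a b _ _ h
      simpa using h
    · rintro n ⟨h, h'⟩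
      have he : Even n := by
        have : Even (n ^ 2) := by rw [h']; exact ⟨2 * m, by push_cast; ring⟩
        exact (Int.even_pow.mp this).1
      obtain ⟨k, rfl⟩ := he
      refine ⟨-k, ⟨?_, ?_⟩, by ring⟩
      · rw [Int.ModEq] at *
        omega
      · push_cast at h'
        linarith
  · rw [add_zero]
    simp only [theta, PowerSeries.coeff_mk]
    convert Nat.cast_zero
    convert Set.ncard_empty ℤ
    refine Set.eq_empty_of_forall_notMem ?_
    rintro m ⟨-, hm⟩
    rcases Int.even_or_odd' m with ⟨k, rfl | rfl⟩
    · apply h4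
      zify
      exact ⟨k ^ 2, by rw [← hm]; ring⟩
    · apply h1
      obtain ⟨t, ht⟩ := Int.even_mul_succ_self k
      rw [← Int.natCast_modEq_iff, ← hm]
      exact (Int.modEq_iff_dvd.mpr ⟨-t, by push_cast; linear_combination -4 * ht⟩)

theorem coeff_theta_mul_theta (l i j : ℤ) (N : ℕ) :
    PowerSeries.coeff N (theta l i * theta l j) =
      (({p : ℤ × ℤ | p.1 ≡ i [ZMOD l] ∧ p.2 ≡ j [ZMOD l] ∧ p.1 ^ 2 + p.2 ^ 2 = (N : ℤ)}.ncard : ℕ) :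
        ZMod 2) := by
  have bound {n : ℤ} (h : n ^ 2 ≤ N) : n ∈ Finset.Icc (-N : ℤ) N := by
    rw [Finset.mem_Icc]
    constructor <;> nlinarith
  set S : Finset (ℤ × ℤ) := {p ∈ Finset.Icc (-N : ℤ) N ×ˢ Finset.Icc (-N : ℤ) N |
    p.1 ≡ i [ZMOD l] ∧ p.2 ≡ j [ZMOD l] ∧ p.1 ^ 2 + p.2 ^ 2 = (N : ℤ)} with hS
  have hset : {p : ℤ × ℤ | p.1 ≡ i [ZMOD l] ∧ p.2 ≡ j [ZMOD l] ∧ p.1 ^ 2 + p.2 ^ 2 = (N : ℤ)} =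
      (S : Set (ℤ × ℤ)) := by
    ext p
    simp only [hS, Set.mem_ofPred_eq, Finset.coe_filter, Finset.mem_product]
    refine ⟨fun h => ⟨⟨bound ?_, bound ?_⟩, h⟩, fun h => h.2⟩
    · nlinarith [sq_nonneg p.2]
    · nlinarith [sq_nonneg p.1]
  have hmaps : Set.MapsTo (fun p : ℤ × ℤ => (p.1.natAbs ^ 2, p.2.natAbs ^ 2)) (S : Set (ℤ × ℤ))
      (Finset.HasAntidiagonal.antidiagonal N : Set (ℕ × ℕ)) := by
    intro p hp
    rw [← hset] at hp
    rw [Finset.mem_coe, Finset.HasAntidiagonal.mem_antidiagonal]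
    zify
    simpa using hp.2.2
  rw [hset, Set.ncard_coe_finset, Finset.card_eq_sum_card_fiberwise hmaps, PowerSeries.coeff_mul,
    Nat.cast_sum]
  refine Finset.sum_congr rfl fun k hk => ?_
  rw [Finset.HasAntidiagonal.mem_antidiagonal] at hk
  simp only [theta, PowerSeries.coeff_mk]
  rw [← Nat.cast_mul, ← Set.ncard_prod, ← Set.ncard_coe_finset]
  congr 2
  ext p
  rw [Finset.coe_filter, Set.mem_ofPred_eq, ← Finset.mem_coe, ← hset, Prod.ext_iff]
  zify
  simp only [Set.mem_prod, Set.mem_ofPred_eq, sq_abs]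
  have hk' : (k.1 : ℤ) + k.2 = N := by exact_mod_cast hk
  constructor
  · rintro ⟨⟨h1, h2⟩, h3, h4⟩
    exact ⟨⟨h1, h3, by rw [h2, h4, hk']⟩, h2, h4⟩
  · rintro ⟨⟨h1, h3, -⟩, h2, h4⟩
    exact ⟨⟨h1, h2⟩, h3, h4⟩

theorem coeff_two_mul_theta_add_mul_theta_sub {l : ℤ} (hl : Odd l) (i j : ℤ) (N : ℕ) :
    PowerSeries.coeff (2 * N) (theta l (i + j) * theta l (i - j)) =
      PowerSeries.coeff N (theta l i * theta l j) := by
  rw [coeff_theta_mul_theta, coeff_theta_mul_theta]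
  congr 1
  symm
  refine Set.ncard_congr (fun p _ => (p.1 + p.2, p.1 - p.2)) ?_ ?_ ?_
  · rintro p ⟨h1, h2, h3⟩
    exact ⟨h1.add h2, h1.sub h2, by push_cast; linear_combination 2 * h3⟩
  · rintro ⟨a, b⟩ ⟨c, d⟩ _ _ h
    simp only [Prod.mk.injEq] at h ⊢
    omega
  · rintro ⟨m, n⟩ ⟨h1, h2, h3⟩
    simp only at h1 h2 h3
    have he : Even (m + n) := by
      have : Even (m ^ 2 + n ^ 2) := by rw [h3]; exact ⟨N, by push_cast; ring⟩
      simpa [Int.even_add, Int.even_pow] using this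
    obtain ⟨u, hu⟩ := he
    obtain rfl : n = 2 * u - m := by omega
    have hcop : IsCoprime l 2 := by
      obtain ⟨k, rfl⟩ := hl
      exact ⟨1, -k, by ring⟩
    have half {x y : ℤ} (h : 2 * x ≡ 2 * y [ZMOD l]) : x ≡ y [ZMOD l] := by
      rw [Int.modEq_iff_dvd, ← mul_sub] at h
      exact Int.modEq_iff_dvd.mpr (hcop.dvd_of_dvd_mul_left h)
    refine ⟨(u, m - u), ⟨half ?_, half ?_, ?_⟩, ?_⟩
    · convert h1.add h2 using 1 <;> ring
    · convert h1.sub h2 using 1 <;> ring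
    · push_cast at h3
      simp only
      linarith
    · simp only [Prod.mk.injEq]
      omega

theorem theta_five_quintic (r : ℤ) :
    theta 5 r ^ 5 + theta 5 (2 * r) ^ 5 =
      theta 5 r * theta 5 (2 * r) + theta 5 r ^ 2 * theta 5 (2 * r) ^ 2 := by
  have hA := (supportedMod_theta_add_pow_four r).of_dvd (show 2 ∣ 8 by norm_num)
  have hB := (supportedMod_theta_add_pow_four (2 * r)).of_dvd (show 2 ∣ 8 by norm_num)
  have h4 : theta 5 (2 * (2 * r)) = theta 5 r := by
    rw [← theta_neg 5 r]
    exact theta_congr (Int.modEq_iff_dvd.mpr ⟨-r, by ring⟩)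
  rw [h4] at hB
  have hab (N : ℕ) : PowerSeries.coeff (2 * N) (theta 5 r * theta 5 (2 * r)) =
      PowerSeries.coeff N (theta 5 r * theta 5 (2 * r)) := by
    have hadd : theta 5 (r + 2 * r) = theta 5 (2 * r) := by
      rw [← theta_neg 5 (2 * r)]
      exact theta_congr (Int.modEq_iff_dvd.mpr ⟨-r, by ring⟩)
    have hsub : theta 5 (r - 2 * r) = theta 5 r := by
      rw [← theta_neg 5 r, show r - 2 * r = -r by ring]
    have h := coeff_two_mul_theta_add_mul_theta_sub (l := 5) (by decide) r (2 * r) N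
    rwa [hadd, hsub, mul_comm (theta 5 (2 * r))] at h
  have hodd : SupportedMod 2 1
      (theta 5 r * theta 5 (2 * r) + theta 5 r ^ 2 * theta 5 (2 * r) ^ 2) := by
    intro n hn
    by_contra h
    obtain ⟨N, rfl⟩ : 2 ∣ n := by
      rw [Nat.ModEq] at h
      omega
    apply hn
    rw [map_add, ← mul_pow, PowerSeries.coeff_sq_zmod_two, if_pos ⟨N, rfl⟩,
      Nat.mul_div_cancel_left _ two_pos, hab, CharTwo.add_self_eq_zero]
  have hsq (f : PowerSeries (ZMod 2)) : SupportedMod 2 0 (f ^ 2) :=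
    (SupportedMod.one_zero f).sq
  have hfour (f : PowerSeries (ZMod 2)) : SupportedMod 2 0 (f ^ 4) :=
    (SupportedMod.one_zero f).pow_four.of_dvd ⟨2, rfl⟩
  generalize theta 5 r = a at *
  generalize theta 5 (2 * r) = b at *
  have h2 := PowerSeries.two_eq_zero_zmod_two
  have ho : SupportedMod 2 1
      (a * b + a ^ 2 * b ^ 2 + ((a + b ^ 4) * a ^ 4 + b ^ 4 * (b + a ^ 4))) :=
    hodd.add ((hA.mul (hfour a)).add ((hfour b).mul hB))
  have he : SupportedMod 2 0
      ((a + b ^ 4) * (b + a ^ 4) + a ^ 4 * b ^ 4 + a ^ 2 * b ^ 2) :=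
    (((hA.mul hB).congr rfl).add ((hfour a).mul (hfour b))).add ((hsq a).mul (hsq b))
  have hEq : a * b + a ^ 2 * b ^ 2 + ((a + b ^ 4) * a ^ 4 + b ^ 4 * (b + a ^ 4)) =
      (a + b ^ 4) * (b + a ^ 4) + a ^ 4 * b ^ 4 + a ^ 2 * b ^ 2 := by
    ring
  have hzero : a * b + a ^ 2 * b ^ 2 + ((a + b ^ 4) * a ^ 4 + b ^ 4 * (b + a ^ 4)) = 0 := by
    ext n
    by_contra hn
    exact absurd ((ho n hn).symm.trans (he n (hEq ▸ hn))) (by decide)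
  linear_combination hzero - (a ^ 4 * b ^ 4 + a * b + a ^ 2 * b ^ 2) * h2

theorem coeff_theta_pow_seven_add {r : ℤ} {n : ℕ} (hn : n ≡ 0 [MOD 8]) :
    PowerSeries.coeff n (theta 5 r ^ 7) =
      PowerSeries.coeff n (theta 5 r ^ 8 * theta 5 (2 * r) ^ 16) := by
  have hA := supportedMod_theta_add_pow_four r
  have hB := supportedMod_theta_add_pow_four (2 * r)
  have hquintic := theta_five_quintic r
  have h4 : theta 5 (2 * (2 * r)) = theta 5 r := by
    rw [← theta_neg 5 r]
    exact theta_congr (Int.modEq_iff_dvd.mpr ⟨-r, by ring⟩)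
  rw [h4] at hB
  generalize theta 5 r = a at *
  generalize theta 5 (2 * r) = b at *
  have h2 := PowerSeries.two_eq_zero_zmod_two
  have all := SupportedMod.one_zero
  have hA2 := hA.sq.of_dvd (show 8 ∣ 2 * 8 by norm_num)
  have hA4 := hA.pow_four.of_dvd (show 8 ∣ 4 * 8 by norm_num)
  have hB4 := hB.pow_four.of_dvd (show 8 ∣ 4 * 8 by norm_num)
  have e1 : PowerSeries.coeff n ((a + b ^ 4) * (a ^ 2 * a ^ 4)) = 0 :=
    SupportedMod.coeff_eq_zero (q := 2) (j := 1)
      ((hA.of_dvd ⟨4, rfl⟩).mul ((all a).sq.mul ((all a).pow_four.of_dvd ⟨2, rfl⟩)))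
      (by rw [Nat.ModEq] at *; omega)
  have e2 : PowerSeries.coeff n (b ^ 4 * (a + b ^ 4) ^ 2 * a ^ 4) = 0 :=
    SupportedMod.coeff_eq_zero (q := 4) (j := 2)
      (((all b).pow_four.mul (hA2.of_dvd ⟨2, rfl⟩)).mul (all a).pow_four)
      (by rw [Nat.ModEq] at *; omega)
  have e3 : PowerSeries.coeff n (a ^ 16 * b ^ 8 * (a + b ^ 4) ^ 4) = 0 := by
    rw [show a ^ 16 = (a ^ 2) ^ 8 by ring]
    exact SupportedMod.coeff_eq_zero (q := 8) (j := 4)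
      (((all (a ^ 2)).pow_eight.mul (all b).pow_eight).mul hA4) (by rw [Nat.ModEq] at *; omega)
  have e4 : PowerSeries.coeff n ((b + a ^ 4) ^ 4 * b ^ 8 * b ^ 16) = 0 := by
    rw [show b ^ 16 = (b ^ 2) ^ 8 by ring]
    exact SupportedMod.coeff_eq_zero (q := 8) (j := 4)
      ((hB4.mul (all b).pow_eight).mul (all (b ^ 2)).pow_eight) (by rw [Nat.ModEq] at *; omega)
  have frob (f g : PowerSeries (ZMod 2)) : (f + g) ^ 4 = f ^ 4 + g ^ 4 :=
    by linear_combination (2 * f ^ 3 * g + 3 * f ^ 2 * g ^ 2 + 2 * f * g ^ 3) * h2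
  have hq4 : a ^ 20 + b ^ 20 = a ^ 4 * b ^ 4 + a ^ 8 * b ^ 8 := by
    have h := congrArg (· ^ 4) hquintic
    simp only [frob] at h
    linear_combination h
  have key : a ^ 7 = a ^ 8 * b ^ 16 + (a + b ^ 4) * (a ^ 2 * a ^ 4) +
      b ^ 4 * (a + b ^ 4) ^ 2 * a ^ 4 + a ^ 16 * b ^ 8 * (a + b ^ 4) ^ 4 +
      (b + a ^ 4) ^ 4 * b ^ 8 * b ^ 16 := by
    rw [frob, frob]
    linear_combination (-b ^ 8) * hq4 - (a ^ 8 * b ^ 16 + a ^ 4 * b ^ 12 + a ^ 6 * b ^ 4 +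
      a ^ 5 * b ^ 8 + a ^ 16 * b ^ 24) * h2
  rw [key]
  simp only [map_add, e1, e2, e3, e4, add_zero]

theorem exists_coeff_ne_zero_of_mul {f g : LaurentSeries (ZMod 2)} {n : ℤ}
    (h : (f * g).coeff n ≠ 0) : ∃ i j, f.coeff i ≠ 0 ∧ g.coeff j ≠ 0 ∧ i + j = n := by
  obtain ⟨i, hi, j, hj, hij⟩ := HahnSeries.support_mul_subset h
  exact ⟨i, j, hi, hj, hij⟩

theorem proj_mul_of_supported {q j : ℤ} {f g : LaurentSeries (ZMod 2)}
    (hf : ∀ n, f.coeff n ≠ 0 → n ≡ 0 [ZMOD q]) : proj q j (f * g) = f * proj q j g := by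
  have hsplit : f * g = f * proj q j g + f * (g - proj q j g) := by ring
  ext n
  change (if n ≡ j [ZMOD q] then (f * g).coeff n else 0) = _
  split_ifs with hn
  · rw [hsplit, HahnSeries.coeff_add, add_eq_left]
    by_contra h
    obtain ⟨i, k, hi, hk, rfl⟩ := exists_coeff_ne_zero_of_mul h
    apply hk
    have : k ≡ j [ZMOD q] := by simpa using (hf i hi).symm.add_right k |>.trans hn
    simp [proj, this]
  · by_contra h
    obtain ⟨i, k, hi, hk, rfl⟩ := exists_coeff_ne_zero_of_mul (Ne.symm h)
    have hkj : k ≡ j [ZMOD q] := by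
      by_contra hne
      exact hk (by simp [proj, hne])
    exact hn (by simpa using (hf i hi).add hkj)

theorem thetaL_ne_zero {l r : ℤ} (h : ¬ l ∣ 2 * r) : thetaL l r ≠ 0 := by
  intro h0
  have hc := congrArg (fun f => HahnSeries.coeff f ((r.natAbs ^ 2 : ℕ) : ℤ)) h0
  simp only [thetaL, LaurentSeries.coeff_coe_powerSeries, theta, PowerSeries.coeff_mk] at hc
  have hs : {n : ℤ | n ≡ r [ZMOD l] ∧ n ^ 2 = ((r.natAbs ^ 2 : ℕ) : ℤ)} = {r} := by
    ext n
    simp only [Set.mem_ofPred_eq, Set.mem_singleton_iff]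
    constructor
    · rintro ⟨h1, h2⟩
      push_cast at h2
      rw [sq_abs, sq_eq_sq_iff_eq_or_eq_neg] at h2
      rcases h2 with rfl | rfl
      · rfl
      · refine absurd ?_ h
        have := h1.dvd
        rwa [show r - -r = 2 * r by ring] at this
    · rintro rfl
      exact ⟨rfl, by simp⟩
  rw [hs, Set.ncard_singleton] at hc
  simp at hc

theorem stmt15 (r : ℤ) (hr : r = 1 ∨ r = 2) :
    proj 8 0 (thetaL 5 r)⁻¹ = thetaL 5 (2 * r) ^ 16 := by
  have h0 : thetaL 5 r ≠ 0 := thetaL_ne_zero (by rcases hr with rfl | rfl <;> decide)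
  have hpow : ∀ k, thetaL 5 r ^ k = ((theta 5 r ^ k : PowerSeries (ZMod 2)) :
      LaurentSeries (ZMod 2)) := fun k => (map_pow _ _ _).symm
  have hsupp : ∀ n, (thetaL 5 r ^ 8).coeff n ≠ 0 → n ≡ 0 [ZMOD 8] := by
    intro n hn
    rw [hpow, PowerSeries.coeff_coe] at hn
    split_ifs at hn with hneg
    · exact absurd rfl hn
    · have := (SupportedMod.one_zero _).pow_eight _ hn
      rw [Nat.ModEq] at this
      rw [Int.ModEq]
      omega
  apply mul_left_cancel₀ (pow_ne_zero 8 h0)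
  rw [← proj_mul_of_supported hsupp, pow_succ, mul_assoc, mul_inv_cancel₀ h0, mul_one, ← pow_succ]
  have hR : thetaL 5 r ^ 8 * thetaL 5 (2 * r) ^ 16 =
      ((theta 5 r ^ 8 * theta 5 (2 * r) ^ 16 : PowerSeries (ZMod 2)) :
        LaurentSeries (ZMod 2)) := by
    rw [map_mul, map_pow, map_pow]
    rfl
  rw [hR, hpow]
  ext n
  change (if n ≡ 0 [ZMOD 8] then _ else _) = _
  rw [PowerSeries.coeff_coe, PowerSeries.coeff_coe]
  split_ifs with hn hneg hneg
  · rfl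
  · apply coeff_theta_pow_seven_add
    rw [Int.ModEq] at hn
    rw [Nat.ModEq]
    omega
  · rfl
  · symm
    have all := SupportedMod.one_zero
    rw [show theta 5 (2 * r) ^ 16 = (theta 5 (2 * r) ^ 2) ^ 8 by ring]
    refine ((all _).pow_eight.mul (all _).pow_eight).coeff_eq_zero fun h => hn ?_
    rw [Nat.ModEq] at h
    rw [Int.ModEq]
    omega
end
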